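/- arXiv:1901.08446 — 3 statements merged into one kernel-verified Lean document; each statement's English description precedes it below -/
import Mathlib

section
/- Let k be a field of characteristic p > 0, m a positive integer with p ∤ m. For c ∈ k let φ_c = t · u_c ∈ k[[t]], where u_c is the unique power series with constant coefficient 1 and u_c^m · (1 + c t^m) = 1. Then for all c, c' ∈ k, substituting φ_{c'} into φ_c yields φ_{c+c'}: φ_c(φ_{c'}(t)) = φ_{c+c'}(t) as formal power series. In particular c ↦ φ_c is a homomorphism from the additive group of k to the group of normalized automorphisms of k[[t]] under substitution. -/
/-- Substitution of a power series `f` with zero constant coefficient into a power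
series `g`: the coefficient of `t^n` in `g(f(t))` is `∑_{j ≤ n} g_j ⬝ (coeff of t^n in f^j)`. -/
noncomputable def PowerSeries.comp {k : Type*} [CommSemiring k]
    (g f : PowerSeries k) : PowerSeries k :=
  PowerSeries.mk fun n =>
    ∑ j ∈ Finset.range (n + 1), PowerSeries.coeff j g * PowerSeries.coeff n (f ^ j)

namespace PowerSeries

theorem comp_eq_subst {k : Type*} [CommRing k] (g f : PowerSeries k)
    (hf : constantCoeff f = 0) : comp g f = g.subst f := by
  ext n
  rw [coeff_subst' (HasSubst.of_constantCoeff_zero' hf), comp, coeff_mk,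
    finsum_eq_sum_of_support_subset (s := Finset.range (n + 1))]
  · simp only [smul_eq_mul]
  · intro j hj
    simp only [Finset.coe_range, Set.mem_Iio]
    by_contra! h
    refine hj ?_
    have hd : (X : PowerSeries k) ^ j ∣ f ^ j := pow_dvd_pow_of_dvd (X_dvd_iff.mpr hf) j
    simp [X_pow_dvd_iff.mp hd n (by omega)]

/-- Over a domain in which `m ≠ 0`, an `m`-th root with constant coefficient `1` is unique. -/
theorem eq_of_pow_eq_pow {k : Type*} [CommRing k] [IsDomain k] {m : ℕ} (hm : (m : k) ≠ 0)
    {v w : PowerSeries k} (hv : constantCoeff v = 1) (hw : constantCoeff w = 1)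
    (h : v ^ m = w ^ m) : v = w := by
  have hz := (Commute.all v w).geom_sum₂_mul m
  rw [h, sub_self, mul_eq_zero] at hz
  rcases hz with hz | hz
  · exact absurd (by simpa [hv, hw] using congrArg constantCoeff hz) hm
  · exact sub_eq_zero.mp hz

end PowerSeries

/-- Let `k` have characteristic `p > 0` and `m ≥ 1` with `p ∤ m`.
For `c ∈ k` let `φ_c = t u_c`, where `u_c` is the unique power series with constant
coefficient `1` and `u_c^m (1 + c t^m) = 1`.  Then `φ_c(φ_{c'}(t)) = φ_{c+c'}(t)`; in
particular `c ↦ φ_c` is a homomorphism from `(k, +)` to the Nottingham group. -/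
theorem phi_substitution_homomorphism
    (k : Type*) [Field k] (p : ℕ) [Fact p.Prime] [CharP k p]
    (m : ℕ) (hm : 0 < m) (hpm : ¬ p ∣ m)
    (u : k → PowerSeries k)
    (hu1 : ∀ c : k, PowerSeries.constantCoeff (u c) = 1)
    (hu : ∀ c : k, (u c) ^ m * (1 + PowerSeries.C c * PowerSeries.X ^ m) = 1) :
    ∀ c c' : k,
      PowerSeries.comp (PowerSeries.X * u c) (PowerSeries.X * u c')
        = PowerSeries.X * u (c + c') := by
  intro c c'
  have hm0 : (m : k) ≠ 0 := fun h => hpm ((CharP.cast_eq_zero_iff k p m).mp h)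
  set a : PowerSeries k := PowerSeries.X * u c' with ha
  have ha0 : PowerSeries.constantCoeff a = 0 := by simp [ha]
  have hs : PowerSeries.HasSubst a := PowerSeries.HasSubst.of_constantCoeff_zero' ha0
  rw [PowerSeries.comp_eq_subst _ _ ha0, PowerSeries.subst_mul hs, PowerSeries.subst_X hs]
  have hS : (u c).subst a ^ m * (1 + PowerSeries.C c * a ^ m) = 1 := by
    have h := congrArg (PowerSeries.substAlgHom hs) (hu c)
    have hC : PowerSeries.substAlgHom hs (PowerSeries.C c) = PowerSeries.C c :=
      (PowerSeries.substAlgHom hs).commutes c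
    simpa only [map_mul, map_pow, map_add, map_one, hC, PowerSeries.substAlgHom_X,
      PowerSeries.coe_substAlgHom] using h
  have hS1 : PowerSeries.constantCoeff ((u c).subst a) = 1 := by
    rw [← PowerSeries.comp_eq_subst _ _ ha0, ← PowerSeries.coeff_zero_eq_constantCoeff_apply]
    simp [PowerSeries.comp, hu1]
  rw [ha, mul_assoc, ← ha]
  congr 1
  refine PowerSeries.eq_of_pow_eq_pow hm0 (by simp [hu1, hS1]) (hu1 _) ?_
  have hw : (u c' * (u c).subst a) ^ m *
      (1 + PowerSeries.C (c + c') * PowerSeries.X ^ m) = 1 := by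
    rw [ha, mul_pow, ← ha] at hS
    rw [map_add, mul_pow]
    linear_combination (u c).subst a ^ m * hu c' + hS
  exact mul_right_cancel₀ (right_ne_zero_of_mul_eq_one hw) (hw.trans (hu _).symm)
end

section
/- Let k be a field of characteristic p > 0, m a positive integer with p ∤ m, and c ∈ k with c ≠ 0. Let φ_c = t · u_c ∈ k[[t]], where u_c is the unique power series with constant coefficient 1 and u_c^m · (1 + c t^m) = 1. Then the normalized automorphism t ↦ φ_c(t) of k[[t]] has order exactly p in the Nottingham group: the p-fold substitution composite of φ_c with itself equals t, while φ_c ≠ t. -/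
theorem PowerSeries.comp_eq_subst_s15 {k : Type*} [CommRing k] (g f : PowerSeries k)
    (hf : constantCoeff f = 0) : comp g f = g.subst f := by
  ext n
  rw [coeff_subst' (HasSubst.of_constantCoeff_zero' hf), comp, coeff_mk,
    finsum_eq_sum_of_support_subset (s := Finset.range (n + 1))]
  · simp only [smul_eq_mul]
  · intro j hj
    by_contra hjn
    simp only [Finset.coe_range, Set.mem_Iio, not_lt] at hjn
    refine hj ?_
    have hdvd : X ^ j ∣ f ^ j := pow_dvd_pow_of_dvd (X_dvd_iff.mpr hf) j
    simp [X_pow_dvd_iff.mp hdvd n (by lia)]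

theorem PowerSeries.constantCoeff_subst_of_constantCoeff_eq_zero {k : Type*} [CommRing k]
    (g f : PowerSeries k) (hf : constantCoeff f = 0) :
    constantCoeff (g.subst f : PowerSeries k) = constantCoeff g := by
  rw [← comp_eq_subst_s15 g f hf, ← coeff_zero_eq_constantCoeff_apply, comp, coeff_mk]
  simp

/-- The group of one-units of `k[[t]]` has no `m`-torsion when `m ≠ 0` in `k`. -/
theorem PowerSeries.eq_one_of_pow_eq_one {k : Type*} [Field k] {m : ℕ} (hm : (m : k) ≠ 0)
    {v : PowerSeries k} (hv : constantCoeff v = 1) (h : v ^ m = 1) : v = 1 := by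
  have hmul : (∑ i ∈ Finset.range m, v ^ i) * (v - 1) = 0 := by
    rw [geom_sum_mul, h, sub_self]
  rcases mul_eq_zero.mp hmul with h0 | h0
  · refine absurd ?_ hm
    simpa [hv] using congrArg (constantCoeff (R := k)) h0
  · exact sub_eq_zero.mp h0

/-- The `n`-fold iterate of `φ_c` is `φ_{nc}`. -/
theorem PowerSeries.exists_iterate_comp_eq {k : Type*} [Field k] {m : ℕ} {c : k}
    {u : PowerSeries k} (hu1 : constantCoeff u = 1) (hu : u ^ m * (1 + C c * X ^ m) = 1) (n : ℕ) :
    ∃ v : PowerSeries k, (fun g => comp g (X * u))^[n] X = X * v ∧ constantCoeff v = 1 ∧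
      v ^ m * (1 + C (n * c) * X ^ m) = 1 := by
  induction n with
  | zero => exact ⟨1, by simp⟩
  | succ n ih =>
    obtain ⟨v, hiter, hv1, hv⟩ := ih
    have hf : constantCoeff (X * u) = 0 := by simp
    have hs : HasSubst (X * u) := HasSubst.of_constantCoeff_zero' hf
    refine ⟨u * v.subst (X * u), ?_, ?_, ?_⟩
    · rw [Function.iterate_succ_apply', hiter, comp_eq_subst_s15 _ _ hf, subst_mul hs, subst_X hs,
        mul_assoc]
    · rw [map_mul, constantCoeff_subst_of_constantCoeff_eq_zero _ _ hf, hu1, hv1, one_mul]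
    · have hC (r : k) : (C r).subst (X * u) = C r := subst_C r
      have h := congrArg (substAlgHom (R := k) hs) hv
      simp only [map_mul, map_add, map_pow, map_one, coe_substAlgHom, subst_X hs] at h
      rw [hC, hC] at h
      simp only [map_mul, Nat.cast_add, Nat.cast_one, map_add, map_one]
      linear_combination (1 + C c * X ^ m) * u ^ m * h + hu -
        (v.subst (X * u) : PowerSeries k) ^ m * u ^ m * C (n : k) * C c * X ^ m * hu

/-- Let `k` have characteristic `p > 0`, `m ≥ 1` with `p ∤ m`, and
`0 ≠ c ∈ k`.  Let `φ_c = t u_c` where `u_c` is the unique power series with constant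
coefficient `1` and `u_c^m (1 + c t^m) = 1`.  Then the normalized automorphism
`t ↦ φ_c(t)` has order exactly `p` in the Nottingham group: the `p`-fold substitution
composite of `φ_c` with itself is `t`, while `φ_c ≠ t`. -/
theorem phi_c_has_order_p
    (k : Type*) [Field k] (p : ℕ) [Fact p.Prime] [CharP k p]
    (m : ℕ) (hm : 0 < m) (hpm : ¬ p ∣ m) (c : k) (hc : c ≠ 0)
    (u : PowerSeries k) (hu1 : PowerSeries.constantCoeff u = 1)
    (hu : u ^ m * (1 + PowerSeries.C c * PowerSeries.X ^ m) = 1) :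
    (fun g : PowerSeries k => PowerSeries.comp g (PowerSeries.X * u))^[p] PowerSeries.X
        = PowerSeries.X
      ∧ PowerSeries.X * u ≠ PowerSeries.X := by
  refine ⟨?_, fun h => ?_⟩
  · obtain ⟨v, hiter, hv1, hv⟩ := PowerSeries.exists_iterate_comp_eq hu1 hu p
    have hvm : v ^ m = 1 := by simpa using hv
    have hm0 : (m : k) ≠ 0 := fun h => hpm ((CharP.cast_eq_zero_iff k p m).mp h)
    rw [hiter, PowerSeries.eq_one_of_pow_eq_one hm0 hv1 hvm, mul_one]
  · have hu_one : u = 1 := mul_left_cancel₀ PowerSeries.X_ne_zero (h.trans (mul_one _).symm)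
    refine hc ?_
    simpa [hu_one, hm.ne', PowerSeries.coeff_C_mul, PowerSeries.coeff_X_pow, PowerSeries.coeff_one]
      using congrArg (PowerSeries.coeff m) hu
end

section
/- Let k be a field of characteristic p > 0 and m a positive integer with p ∤ m. Let C ∈ k((t)) be a nonzero formal Laurent series with t-adic order ord_t(C) > −m, so that 1 + C t^m ∈ k[[t]] has constant coefficient 1; let u ∈ k[[t]] be the unique power series with constant coefficient 1 and u^m · (1 + C t^m) = 1, and set φ = t · u. Then ord_t(φ − t) = m + ord_t(C) + 1. (Equivalently, if C has pole order w = −ord_t(C), the corresponding automorphism σ : t ↦ t (1 + C t^m)^{−1/m} satisfies v(σ(t) − t) = m − w + 1.) -/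
/-- A power series with nonzero constant coefficient has order zero as a Laurent series. -/
theorem PowerSeries.order_coe_of_constantCoeff_ne_zero {k : Type*} [Field k] (f : PowerSeries k)
    (hf : PowerSeries.constantCoeff (R := k) f ≠ 0) : (f : LaurentSeries k).order = 0 := by
  have h0 : (f : LaurentSeries k).coeff 0 ≠ 0 := by
    simpa [PowerSeries.coeff_coe] using hf
  refine le_antisymm (HahnSeries.order_le_of_coeff_ne_zero h0) ?_
  rw [HahnSeries.le_order_iff_forall (HahnSeries.ne_zero_of_coeff_ne_zero h0)]
  intro j hj
  rw [PowerSeries.coeff_coe, if_pos hj]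

/-- Let `k` have characteristic `p > 0` and `m ≥ 1` with `p ∤ m`.
Let `C ∈ k((t))` be nonzero with `ord_t C > -m`, so that `1 + C t^m` is a power series
with constant coefficient `1`; let `u ∈ k[[t]]` have constant coefficient `1` with
`u^m (1 + C t^m) = 1`, and `φ = t u`.  Then `ord_t(φ - t) = m + ord_t(C) + 1`; i.e. the
automorphism `σ : t ↦ t (1 + C t^m)^{-1/m}` satisfies `v(σ(t) - t) = m - w + 1` where
`w` is the pole order of `C`. -/
theorem order_of_sigma_t_sub_t
    (k : Type*) [Field k] (p : ℕ) [Fact p.Prime] [CharP k p]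
    (m : ℕ) (hm : 0 < m) (hpm : ¬ p ∣ m)
    (C : LaurentSeries k) (hC : C ≠ 0) (hCord : -(m : ℤ) < C.order)
    (g : PowerSeries k)
    (hg : (g : LaurentSeries k)
      = 1 + C * ((PowerSeries.X : PowerSeries k) : LaurentSeries k) ^ m)
    (u : PowerSeries k) (hu1 : PowerSeries.constantCoeff (R := k) u = 1)
    (hu : u ^ m * g = 1) :
    (((PowerSeries.X * u : PowerSeries k) : LaurentSeries k)
        - ((PowerSeries.X : PowerSeries k) : LaurentSeries k)).order
      = (m : ℤ) + C.order + 1 := by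
  have hinj := HahnSeries.ofPowerSeries_injective (Γ := ℤ) (R := k)
  have hmk : (m : k) ≠ 0 := by rwa [Ne, CharP.cast_eq_zero_iff k p]
  have hX : (((PowerSeries.X : PowerSeries k) : LaurentSeries k)).order = 1 := by simp
  have hX0 : ((PowerSeries.X : PowerSeries k) : LaurentSeries k) ≠ 0 := by simp
  set S : PowerSeries k := ∑ i ∈ Finset.range m, u ^ i with hS
  have hSc : PowerSeries.constantCoeff (R := k) S ≠ 0 := by simpa [hS, hu1] using hmk
  have hu0 : u ≠ 0 := by
    rintro rfl
    simp at hu1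
  have hS0 : S ≠ 0 := by
    intro h
    simp [h] at hSc
  have huL : (u : LaurentSeries k) ≠ 0 := (map_ne_zero_iff _ hinj).2 hu0
  have hSL : (S : LaurentSeries k) ≠ 0 := (map_ne_zero_iff _ hinj).2 hS0
  have hfac : (S : LaurentSeries k) * ((u : LaurentSeries k) - 1)
      = -((u : LaurentSeries k) ^ m
        * (C * ((PowerSeries.X : PowerSeries k) : LaurentSeries k) ^ m)) := by
    have h1 : S * (u - 1) = -(u ^ m * (g - 1)) := by
      rw [hS, geom_sum_mul, mul_sub, hu]
      ring
    have h2 := congrArg (HahnSeries.ofPowerSeries ℤ k) h1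
    simpa only [map_mul, map_sub, map_neg, map_one, map_pow, hg, add_sub_cancel_left] using h2
  have hne : (u : LaurentSeries k) - 1 ≠ 0 := by
    intro h
    rw [h, mul_zero, eq_comm, neg_eq_zero] at hfac
    exact mul_ne_zero (pow_ne_zero _ huL) (mul_ne_zero hC (pow_ne_zero _ hX0)) hfac
  have hord := congrArg HahnSeries.order hfac
  rw [HahnSeries.order_neg, HahnSeries.order_mul hSL hne,
    HahnSeries.order_mul (pow_ne_zero _ huL) (mul_ne_zero hC (pow_ne_zero _ hX0)),
    HahnSeries.order_mul hC (pow_ne_zero _ hX0), HahnSeries.order_pow, HahnSeries.order_pow, hX,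
    PowerSeries.order_coe_of_constantCoeff_ne_zero S hSc,
    PowerSeries.order_coe_of_constantCoeff_ne_zero u (by simp [hu1])] at hord
  have hφ : ((PowerSeries.X * u : PowerSeries k) : LaurentSeries k)
      - ((PowerSeries.X : PowerSeries k) : LaurentSeries k)
      = ((PowerSeries.X : PowerSeries k) : LaurentSeries k) * ((u : LaurentSeries k) - 1) := by
    rw [map_mul, mul_sub, mul_one]
  rw [hφ, HahnSeries.order_mul hX0 hne, hX]
  simp only [nsmul_eq_mul, mul_zero, mul_one, zero_add] at hord
  rw [hord]
  ring
end
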